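/- Let k ≥ 4 be an even integer, ω = exp(2πi/k), and let H be the Hermitian adjacency matrix of a connected mixed graph on a finite nonempty vertex set V, with Δ the maximum degree of the underlying graph. If −Δ is an eigenvalue of H, then the underlying graph of H is Δ-regular, and there exists f : V → ZMod k such that for all u, v: if H u v = 1 then f v − f u = k/2 in ZMod k, and if H u v = ω then f v − f u = k/2 − 1 in ZMod k. -/

import Mathlib

open Matrix

/-- If complex numbers in the closed disc of radius `M = ‖c‖ > 0`, at most `d` in number, sum to
`d * c`, then there are exactly `d` of them and each is equal to `c`. -/
theorem eq_of_sum_eq_of_norm_le {ι : Type*} (s : Finset ι) (a : ι → ℂ) (c : ℂ) (d : ℕ)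
    (hc : c ≠ 0) (ha : ∀ i ∈ s, ‖a i‖ ≤ ‖c‖) (hs : s.card ≤ d)
    (hsum : ∑ i ∈ s, a i = d * c) : s.card = d ∧ ∀ i ∈ s, a i = c := by
  have hpos : 0 < ‖c‖ := norm_pos_iff.mpr hc
  have hcard : s.card = d := by
    refine le_antisymm hs ?_
    have h1 : (d : ℝ) * ‖c‖ ≤ s.card * ‖c‖ := by
      calc (d : ℝ) * ‖c‖ = ‖∑ i ∈ s, a i‖ := by simp [hsum]
        _ ≤ s.card * ‖c‖ := by simpa using norm_sum_le_of_le s ha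
    exact_mod_cast le_of_mul_le_mul_right h1 hpos
  have hnn : ∀ i ∈ s, ‖a i - c‖ ^ 2 ≤ 2 * (c * (starRingEnd ℂ) c - a i * (starRingEnd ℂ) c).re := by
    intro i hi
    have h1 := pow_le_pow_left₀ (norm_nonneg _) (ha i hi) 2
    rw [← Complex.normSq_eq_norm_sq, ← Complex.normSq_eq_norm_sq] at h1
    rw [← Complex.normSq_eq_norm_sq, Complex.normSq_sub, Complex.sub_re, Complex.mul_conj,
      Complex.ofReal_re]
    linarith
  have hzero : ∑ i ∈ s, 2 * (c * (starRingEnd ℂ) c - a i * (starRingEnd ℂ) c).re = 0 := by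
    rw [← Finset.mul_sum, ← Complex.re_sum, Finset.sum_sub_distrib, ← Finset.sum_mul s a, hsum,
      Finset.sum_const, hcard, nsmul_eq_mul, mul_assoc, sub_self, Complex.zero_re, mul_zero]
  refine ⟨hcard, fun i hi => ?_⟩
  have h0 := (Finset.sum_eq_zero_iff_of_nonneg
    fun j hj => (sq_nonneg _).trans (hnn j hj)).mp hzero i hi
  have h1 := hnn i hi
  rw [h0] at h1
  exact sub_eq_zero.mp (norm_eq_zero.mp (pow_eq_zero_iff two_ne_zero |>.mp
    (le_antisymm h1 (sq_nonneg _))))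

/-- A property of vertices that holds somewhere and passes to neighbours holds everywhere in a
connected graph. -/
theorem SimpleGraph.Connected.forall_of_adj {V : Type*} {G : SimpleGraph V} (hG : G.Connected)
    {p : V → Prop} {v : V} (hv : p v) (h : ∀ u w, G.Adj u w → p u → p w) (w : V) : p w := by
  obtain ⟨q⟩ := hG.preconnected v w
  induction q with
  | nil => exact hv
  | cons hadj _ ih => exact ih (h _ _ hadj hv)

/-- An eigenvector for `-Δ` of a matrix supported on the edges of a connected graph, with entries
of norm at most one there, vanishes nowhere; the graph is regular, and each edge relates the two
values by the negated entry. -/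
theorem regular_and_entry_mul_eq_neg {V : Type*} [Fintype V] [Nonempty V]
    (H : Matrix V V ℂ) (G : SimpleGraph V) [DecidableRel G.Adj]
    (hsupp : ∀ u v, ¬ G.Adj u v → H u v = 0) (hnorm : ∀ u v, G.Adj u v → ‖H u v‖ ≤ 1)
    (hconn : G.Connected) (x : V → ℂ) (hx : x ≠ 0)
    (heig : H.mulVec x = (-(G.maxDegree : ℂ)) • x) :
    G.IsRegularOfDegree G.maxDegree ∧ (∀ v, x v ≠ 0) ∧
      ∀ u v, G.Adj u v → H u v * x v = - x u := by
  obtain ⟨m, hm⟩ := Finite.exists_max fun v => ‖x v‖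
  have hm0 : 0 < ‖x m‖ := by
    obtain ⟨w, hw⟩ := Function.ne_iff.mp hx
    exact (norm_pos_iff.mpr hw).trans_le (hm w)
  have key : ∀ v, ‖x v‖ = ‖x m‖ →
      G.degree v = G.maxDegree ∧ ∀ u ∈ G.neighborFinset v, H v u * x u = - x v := by
    intro v hv
    refine eq_of_sum_eq_of_norm_le (G.neighborFinset v) (fun u => H v u * x u) (-x v) _ ?_ ?_
      (G.degree_le_maxDegree v) ?_
    · rw [neg_ne_zero, ← norm_pos_iff, hv]
      exact hm0
    · intro u hu
      rw [norm_mul, norm_neg, hv]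
      have h1 := hnorm v u ((G.mem_neighborFinset v u).mp hu)
      exact (mul_le_of_le_one_left (norm_nonneg _) h1).trans (hm u)
    · have h1 := congrFun heig v
      simp only [Matrix.mulVec, dotProduct, Pi.smul_apply, smul_eq_mul] at h1
      rw [mul_neg, ← neg_mul, ← h1]
      refine Finset.sum_subset (Finset.subset_univ _) fun u _ hu => ?_
      rw [hsupp v u (by simpa using hu), zero_mul]
  have hall : ∀ v, ‖x v‖ = ‖x m‖ := by
    refine hconn.forall_of_adj (v := m) rfl fun u w huw hu => le_antisymm (hm w) ?_
    rw [← hu, ← norm_neg, ← (key u hu).2 w (by simpa using huw), norm_mul]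
    exact mul_le_of_le_one_left (norm_nonneg _) (hnorm u w huw)
  refine ⟨fun v => (key v (hall v)).1, fun v => ?_, fun u v huv => ?_⟩
  · rw [← norm_pos_iff, hall]
    exact hm0
  · exact (key u (hall u)).2 v (by simpa using huv)

/-- Let `k ≥ 4` be even. If `-Δ` is an eigenvalue of the Hermitian adjacency matrix of a
connected mixed graph `H`, then the underlying graph is `Δ`-regular and the vertex set admits
a partition `f : V → ZMod k` such that along each undirected edge `f` increases by `k/2` and
along each arc `f` increases by `k/2 - 1`. -/
theorem stmt_11 {V : Type*} [Fintype V] [DecidableEq V] [Nonempty V]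
    (k : ℕ) (hk : 4 ≤ k) (hkeven : Even k) (ω : ℂ)
    (hω : ω = Complex.exp (2 * (Real.pi : ℂ) * Complex.I / (k : ℂ)))
    (H : Matrix V V ℂ) (hherm : H.IsHermitian) (hdiag : ∀ v, H v v = 0)
    (hent : ∀ u v, H u v ∈ ({0, 1, ω, (starRingEnd ℂ) ω} : Set ℂ))
    (G : SimpleGraph V) [DecidableRel G.Adj]
    (hadj : ∀ u v, G.Adj u v ↔ u ≠ v ∧ H u v ≠ 0)
    (hconn : G.Connected)
    (heig : ∃ x : V → ℂ, x ≠ 0 ∧ H.mulVec x = (-(G.maxDegree : ℂ)) • x) :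
    G.IsRegularOfDegree G.maxDegree ∧
      ∃ f : V → ZMod k, ∀ u v,
        (H u v = 1 → f v - f u = ((k / 2 : ℕ) : ZMod k)) ∧
        (H u v = ω → f v - f u = ((k / 2 : ℕ) : ZMod k) - 1) := by
  obtain ⟨x, hx, heig⟩ := heig
  have hk0 : k ≠ 0 := by omega
  have hprim : IsPrimitiveRoot ω k := hω ▸ Complex.isPrimitiveRoot_exp k hk0
  have hω1 : ‖ω‖ = 1 := hprim.norm'_eq_one hk0
  have hω0 : ω ≠ 0 := hprim.ne_zero hk0
  have hhalf : ω ^ (k / 2) = -1 :=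
    (hprim.pow (by omega) (Nat.div_mul_cancel hkeven.two_dvd).symm).eq_neg_one_of_two_right
  have hconj : (starRingEnd ℂ) ω = ω ^ (k - 1) := by
    rw [← Complex.inv_eq_conj hω1]
    refine inv_eq_of_mul_eq_one_right ?_
    rw [← pow_succ', Nat.sub_add_cancel (by omega), hprim.pow_eq_one]
  have hne : ∀ u v, H u v ≠ 0 → G.Adj u v := fun u v h =>
    (hadj u v).mpr ⟨fun huv => h (huv ▸ hdiag u), h⟩
  have hpow : ∀ u v, G.Adj u v → ∃ n : ℕ, H u v = ω ^ n := by
    intro u v huv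
    rcases hent u v with h | h | h | h
    · exact absurd h ((hadj u v).mp huv).2
    · exact ⟨0, by simpa using h⟩
    · exact ⟨1, by simpa using h⟩
    · exact ⟨k - 1, hconj ▸ h⟩
  obtain ⟨hreg, hx0, hedge⟩ := regular_and_entry_mul_eq_neg H G
    (fun u v h => by_contra fun h0 => h (hne u v h0))
    (fun u v huv => by
      obtain ⟨n, hn⟩ := hpow u v huv
      rw [hn, norm_pow, hω1, one_pow])
    hconn x hx heig
  refine ⟨hreg, ?_⟩
  obtain ⟨r⟩ := ‹Nonempty V›
  have hroot : ∀ v, ∃ n : ℕ, x v = ω ^ n * x r := by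
    refine hconn.forall_of_adj (v := r) ⟨0, by simp⟩ ?_
    rintro u w huw ⟨n, hn⟩
    obtain ⟨m, hm⟩ := hpow w u huw.symm
    refine ⟨k / 2 + m + n, ?_⟩
    rw [pow_add, pow_add, hhalf, ← hm, mul_assoc, ← hn, mul_assoc, hedge w u huw.symm]
    ring
  choose n hn using hroot
  have hcast : ∀ a b : ℕ, ω ^ a * x r = ω ^ b * x r → (a : ZMod k) = b := by
    intro a b hab
    have hab' := mul_right_cancel₀ (hx0 r) hab
    rw [ZMod.natCast_eq_natCast_iff, hprim.eq_orderOf]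
    exact (hprim.isOfFinOrder hk0).pow_eq_pow_iff_modEq.mp hab'
  refine ⟨fun v => (n v : ZMod k), fun u v => ⟨fun h => ?_, fun h => ?_⟩⟩
  · have he := hedge u v (hne u v (h ▸ one_ne_zero))
    have := hcast (n v) (k / 2 + n u) (by
      rw [pow_add, hhalf, mul_assoc, ← hn, ← hn, neg_one_mul, ← he, h, one_mul])
    push_cast at this
    linear_combination this
  · have he := hedge u v (hne u v (h ▸ hω0))
    have := hcast (1 + n v) (k / 2 + n u) (by
      rw [pow_add, pow_add, hhalf, mul_assoc, mul_assoc, ← hn, ← hn, neg_one_mul, ← he, h,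
        pow_one])
    push_cast at this
    linear_combination this
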